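/- arXiv:1908.04036 — 3 statements merged into one kernel-verified Lean document; each statement's English description precedes it below -/
import Mathlib

section
/- For all integers K ≥ 1, t with 0 ≤ t ≤ K, and every integer m ≥ 1, the inequality K·(C(K, t+1) − C(K−m, t+1)) ≤ m·(K−t)·C(K, t) holds; equivalently, (C(K, t+1) − C(K−m, t+1)) / C(K, t) ≤ m·(1 − t/K). -/
theorem binom_aux (n t m : ℕ) :
    Nat.choose (n + 1) (t + 1) ≤ Nat.choose (n + 1 - m) (t + 1) + m * Nat.choose n t := by
  induction m with
  | zero => simp
  | succ m ih =>
    have h : Nat.choose (n + 1 - m) (t + 1) ≤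
        Nat.choose (n + 1 - (m + 1)) (t + 1) + Nat.choose n t := by
      rcases Nat.lt_or_ge n m with h | h
      · have h0 : n + 1 - m = 0 := by omega
        rw [h0]
        simp
      · have h0 : n + 1 - m = (n - m) + 1 := by omega
        have h1 : n + 1 - (m + 1) = n - m := by omega
        rw [h0, h1, Nat.choose_succ_succ']
        have := Nat.choose_le_choose t (Nat.sub_le n m)
        omega
    rw [Nat.add_mul, one_mul]
    omega

/-- For all integers `K ≥ 1`, `0 ≤ t ≤ K`, and `m ≥ 1`,
`K·(C(K, t+1) − C(K−m, t+1)) ≤ m·(K−t)·C(K, t)`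
(natural-number truncated subtraction). -/
theorem binom_difference_bound (K t m : ℕ) (hK : 1 ≤ K) (ht : t ≤ K) (hm : 1 ≤ m) :
    K * (Nat.choose K (t + 1) - Nat.choose (K - m) (t + 1)) ≤
      m * (K - t) * Nat.choose K t := by
  obtain ⟨n, rfl⟩ : ∃ n, K = n + 1 := ⟨K - 1, by omega⟩
  have h1 := Nat.add_one_mul_choose_eq n t
  have h2 := Nat.choose_succ_right_eq (n + 1) t
  have h3 := binom_aux n t m
  calc (n + 1) * (Nat.choose (n + 1) (t + 1) - Nat.choose (n + 1 - m) (t + 1))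
      ≤ (n + 1) * (m * Nat.choose n t) := Nat.mul_le_mul_left _ (by omega)
    _ = m * ((n + 1) * Nat.choose n t) := by ring
    _ = m * (Nat.choose (n + 1) t * (n + 1 - t)) := by rw [h1, h2]
    _ = m * (n + 1 - t) * Nat.choose (n + 1) t := by ring
end

section
/- For all integers K ≥ 1, 0 ≤ t ≤ K−1, and 1 ≤ w ≤ K, setting γ = t/K, the inequality (1 + wγ)·(C(K, t+1) − C(K−w, t+1)) ≤ 2·w·(1−γ)·C(K, t) holds; equivalently, (C(K, t+1) − C(K−w, t+1)) / C(K, t) ≤ 4 · (1/2)·w(1−γ)/(1+wγ). -/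
lemma gap_aux (K s : ℕ) (hs : 1 ≤ s) (w : ℕ) (hw : w ≤ K) :
    (Nat.choose K s : ℝ) * ((K : ℝ) - w - w * s) ≤
      ((K : ℝ) - w + w * s) * (Nat.choose (K - w) s : ℝ) := by
  induction w with
  | zero => simp [mul_comm]
  | succ w ih =>
    have ih := ih (by omega)
    obtain ⟨n, rfl⟩ : ∃ n, K = n + 1 + w := ⟨K - (w + 1), by omega⟩
    have e1 : n + 1 + w - w = n + 1 := by omega
    have e2 : n + 1 + w - (w + 1) = n := by omega
    rw [e1] at ih
    rw [e2]
    have hs' : (1 : ℝ) ≤ s := by exact_mod_cast hs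
    have hw0 : (0 : ℝ) ≤ w := by positivity
    have hn0 : (0 : ℝ) ≤ n := by positivity
    have hx0 : (0 : ℝ) ≤ (w : ℝ) * s := by positivity
    have hA : (0 : ℝ) ≤ (Nat.choose (n + 1 + w) s : ℝ) := by positivity
    have hB : (0 : ℝ) ≤ (Nat.choose n s : ℝ) := by positivity
    generalize (Nat.choose (n + 1 + w) s : ℝ) = A at *
    push_cast at ih ⊢
    have c1 : (n : ℝ) + 1 + w - w = n + 1 := by ring
    have c2 : (n : ℝ) + 1 + w - (w + 1) = n := by ring
    have c3 : ((w : ℝ) + 1) * s = w * s + s := by ring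
    rw [c1] at ih
    rw [c2, c3]
    by_cases h : (n : ℝ) ≤ w * s + s
    · calc _ ≤ (0 : ℝ) := mul_nonpos_of_nonneg_of_nonpos hA (by linarith)
        _ ≤ _ := by positivity
    push Not at h
    have hsn : s ≤ n + 1 := by
      have : (s : ℝ) ≤ n + 1 := by linarith
      exact_mod_cast this
    have hc := Nat.choose_mul_succ_eq n s
    have hc' : (Nat.choose n s : ℝ) * (n + 1) = (Nat.choose (n + 1) s : ℝ) * (n + 1 - s) := by
      have := congrArg (Nat.cast : ℕ → ℝ) hc
      push_cast [Nat.cast_sub hsn] at this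
      exact this
    generalize (Nat.choose (n + 1) s : ℝ) = B at *
    generalize (Nat.choose n s : ℝ) = B' at *
    generalize (w : ℝ) * s = x at *
    generalize (s : ℝ) = r at *
    generalize (n : ℝ) = p at *
    have key : (p + 1) * (p + 1 + x) * (p - (x + r)) ≤
        (p + (x + r)) * (p + 1 - r) * (p + 1 - x) := by
      have h1 : 0 ≤ (p + 1) * r * (p + 1 - r) :=
        mul_nonneg (by positivity) (by linarith)
      have h2 : 0 ≤ (p + 1) * (2 * x + r) := by positivity
      have h3 : 0 ≤ (x + r - 1) * (r * x) :=
        mul_nonneg (by linarith) (by positivity)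
      linarith
    have hpos : 0 < (p + 1) * (p + 1 + x) := by positivity
    refine le_of_mul_le_mul_left ?_ hpos
    have k1 := mul_le_mul_of_nonneg_left key hA
    have hq : 0 ≤ (p + (x + r)) * (p + 1 - r) := mul_nonneg (by positivity) (by linarith)
    have k2 := mul_le_mul_of_nonneg_left ih hq
    have k3 : (p + 1) * (p + 1 + x) * ((p + (x + r)) * B') =
        (p + (x + r)) * (p + 1 - r) * ((p + 1 + x) * B) := by
      linear_combination (p + 1 + x) * (p + (x + r)) * hc'
    rw [k3]
    linarith

/-- For integers `K ≥ 1`, `0 ≤ t ≤ K−1`, `1 ≤ w ≤ K`, with `γ = t/K`,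
`(1 + wγ)·(C(K, t+1) − C(K−w, t+1)) ≤ 2·w·(1−γ)·C(K, t)`:
the combinatorial core of the factor-4 optimality gap. -/
theorem gap_core_bound (K t w : ℕ) (hK : 1 ≤ K) (ht : t ≤ K - 1)
    (hw1 : 1 ≤ w) (hwK : w ≤ K) :
    (1 + (w : ℝ) * ((t : ℝ) / (K : ℝ))) *
        ((Nat.choose K (t + 1) : ℝ) - (Nat.choose (K - w) (t + 1) : ℝ)) ≤
      2 * (w : ℝ) * (1 - (t : ℝ) / (K : ℝ)) * (Nat.choose K t : ℝ) := by
  have h := gap_aux K (t + 1) (by omega) w hwK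
  have htK : t ≤ K := by omega
  have hc : (Nat.choose K (t + 1) : ℝ) * (t + 1) = (Nat.choose K t : ℝ) * (K - t) := by
    have := congrArg (Nat.cast : ℕ → ℝ) (Nat.choose_succ_right_eq K t)
    push_cast [Nat.cast_sub htK] at this
    exact this
  have hK0 : (0 : ℝ) < K := by exact_mod_cast hK
  push_cast at h
  refine le_of_mul_le_mul_left ?_ hK0
  generalize (Nat.choose K (t + 1) : ℝ) = A at *
  generalize (Nat.choose (K - w) (t + 1) : ℝ) = B at *
  generalize (Nat.choose K t : ℝ) = C at *
  have l : (K : ℝ) * ((1 + (w : ℝ) * ((t : ℝ) / (K : ℝ))) * (A - B)) =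
      (K + w * t) * (A - B) := by
    field_simp
  have r : (K : ℝ) * (2 * (w : ℝ) * (1 - (t : ℝ) / (K : ℝ)) * C) =
      2 * w * (A * (t + 1)) := by
    rw [hc]
    field_simp
  rw [l, r]
  linarith
end

section
/- Let K ≥ 1 and 0 ≤ t ≤ K−1 be integers, set γ = t/K, and let α_1, …, α_K be real numbers satisfying 1 − C(K−k, t+1)/C(K, t+1) ≤ α_k ≤ 1 for every k ∈ {1,…,K}. Then max_{w ∈ {1,…,K}} (C(K, t+1) − C(K−w, t+1)) / (α_w · C(K, t)) = K(1−γ)/(1+Kγ) = (K−t)/(t+1). -/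
/-- Corollary 1: for `K ≥ 1`, `0 ≤ t ≤ K−1`, `γ = t/K`, and capacities `α_k` with
`1 − C(K−k, t+1)/C(K, t+1) ≤ α_k ≤ 1`,
`max_{w ∈ {1,…,K}} (C(K, t+1) − C(K−w, t+1)) / (α_w · C(K, t))
  = K(1−γ)/(1+Kγ) = (K−t)/(t+1)`. -/
theorem degraded_but_optimal (K t : ℕ) (hK : 1 ≤ K) (ht : t ≤ K - 1)
    (α : ℕ → ℝ)
    (hα : ∀ k ∈ Finset.Icc 1 K,
      1 - (Nat.choose (K - k) (t + 1) : ℝ) / (Nat.choose K (t + 1) : ℝ) ≤ α k ∧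
      α k ≤ 1) :
    (Finset.Icc 1 K).sup' (Finset.nonempty_Icc.mpr hK)
        (fun w => ((Nat.choose K (t + 1) : ℝ) - (Nat.choose (K - w) (t + 1) : ℝ)) /
          (α w * (Nat.choose K t : ℝ))) =
      (K : ℝ) * (1 - (t : ℝ) / (K : ℝ)) / (1 + (K : ℝ) * ((t : ℝ) / (K : ℝ))) ∧
    (K : ℝ) * (1 - (t : ℝ) / (K : ℝ)) / (1 + (K : ℝ) * ((t : ℝ) / (K : ℝ))) =
      ((K : ℝ) - (t : ℝ)) / ((t : ℝ) + 1) := by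
  have htK : t + 1 ≤ K := by omega
  have hC : (0 : ℝ) < (Nat.choose K (t + 1) : ℝ) := by exact_mod_cast Nat.choose_pos htK
  have hD : (0 : ℝ) < (Nat.choose K t : ℝ) := by
    exact_mod_cast Nat.choose_pos (show t ≤ K by omega)
  have hK0 : (K : ℝ) ≠ 0 := by
    have : K ≠ 0 := by omega
    exact_mod_cast this
  have ht1 : (0 : ℝ) < (t : ℝ) + 1 := by positivity
  have h2 : (K : ℝ) * (1 - (t : ℝ) / (K : ℝ)) / (1 + (K : ℝ) * ((t : ℝ) / (K : ℝ))) =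
      ((K : ℝ) - (t : ℝ)) / ((t : ℝ) + 1) := by
    rw [mul_sub, mul_div_cancel₀ _ hK0, mul_one, add_comm]
  have hrec : (Nat.choose K (t + 1) : ℝ) * ((t : ℝ) + 1) =
      (Nat.choose K t : ℝ) * ((K : ℝ) - (t : ℝ)) := by
    have h := Nat.choose_succ_right_eq K t
    rw [← Nat.cast_sub (show t ≤ K by omega)]
    exact_mod_cast h
  have h3 : ((K : ℝ) - (t : ℝ)) / ((t : ℝ) + 1) =
      (Nat.choose K (t + 1) : ℝ) / (Nat.choose K t : ℝ) := by
    rw [div_eq_div_iff ht1.ne' hD.ne']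
    linarith
  refine ⟨?_, h2⟩
  rw [h2, h3]
  apply le_antisymm
  · apply Finset.sup'_le
    intro w hw
    have h1 := (hα w hw).1
    have hle : (Nat.choose (K - w) (t + 1) : ℝ) ≤ (Nat.choose K (t + 1) : ℝ) := by
      exact_mod_cast Nat.choose_le_choose (t + 1) (Nat.sub_le K w)
    have hnum : (Nat.choose K (t + 1) : ℝ) - (Nat.choose (K - w) (t + 1) : ℝ) ≤
        α w * (Nat.choose K (t + 1) : ℝ) := by
      have h := mul_le_mul_of_nonneg_right h1 hC.le
      rwa [sub_mul, one_mul, div_mul_cancel₀ _ hC.ne'] at h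
    have ha : 0 ≤ α w := by
      have : (Nat.choose (K - w) (t + 1) : ℝ) / (Nat.choose K (t + 1) : ℝ) ≤ 1 :=
        (div_le_one hC).2 hle
      linarith
    show _ / _ ≤ _
    rw [← div_div]
    apply div_le_div_of_nonneg_right _ hD.le
    apply div_le_of_le_mul₀ ha hC.le
    linarith
  · have hm : K ∈ Finset.Icc 1 K := Finset.mem_Icc.2 ⟨hK, le_rfl⟩
    have hk := hα K hm
    have hz : Nat.choose (K - K) (t + 1) = 0 := by simp
    rw [hz] at hk
    have ha : α K = 1 := by
      apply le_antisymm hk.2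
      simpa using hk.1
    refine le_trans (le_of_eq ?_) (Finset.le_sup' _ hm)
    simp only [hz, ha]
    simp
end
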